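/- arXiv:1212.3544 — 3 statements merged into one kernel-verified Lean document; each statement's English description precedes it below -/
import Mathlib

section
/- Let K ≥ 1 and N > 2K be integers, θ_s = 2πs/N, ρ > 1. Let C be the N×2K real matrix with entries C_{s,2m-1} = cos(mθ_s), C_{s,2m} = sin(mθ_s), and let D be the 2K×2K diagonal matrix with diagonal entries D_{2m-1,2m-1} = D_{2m,2m} = 1/(2π m ρᵐ). Define the operator L from 2K×2K real matrices to N×N real matrices by L(M) = C D M D Cᵀ, and define L⁺(V) = (4/N²)·D⁻¹ Cᵀ V C D⁻¹ for N×N real matrices V. Then L⁺ is the Moore–Penrose pseudo-inverse of L, i.e. L∘L⁺∘L = L, L⁺∘L∘L⁺ = L⁺, and the operators L∘L⁺ and L⁺∘L are self-adjoint with respect to the Frobenius inner product. -/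
open Matrix

theorem sin_int_mul_pi_div_ne_zero {N : ℕ} {k : ℤ} (hk : ¬ (N : ℤ) ∣ k) (hN : N ≠ 0) :
    Real.sin (k * Real.pi / N) ≠ 0 := by
  intro h
  obtain ⟨n, hn⟩ := Real.sin_eq_zero_iff.mp h
  have hN' : (N : ℝ) ≠ 0 := Nat.cast_ne_zero.mpr hN
  have hk' : (k : ℝ) = N * n := by
    field_simp at hn
    linarith
  exact hk ⟨n, by exact_mod_cast hk'⟩

theorem sum_cos_int_mul_eq_zero {N : ℕ} {k : ℤ} (hk : ¬ (N : ℤ) ∣ k) (hN : N ≠ 0) :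
    ∑ s : Fin N, Real.cos (k * (2 * Real.pi * (s.val + 1) / N)) = 0 := by
  have hN' : (N : ℝ) ≠ 0 := Nat.cast_ne_zero.mpr hN
  rw [Fin.sum_univ_eq_sum_range (fun s : ℕ => Real.cos (k * (2 * Real.pi * (s + 1) / N)))]
  refine (mul_eq_zero.mp ?_).resolve_left
    (mul_ne_zero two_ne_zero (sin_int_mul_pi_div_ne_zero hk hN))
  have step (s : ℕ) : 2 * Real.sin (k * Real.pi / N) *
      Real.cos (k * (2 * Real.pi * (s + 1) / N)) =
      Real.sin (k * Real.pi * (2 * (s + 1 : ℕ) + 1) / N) -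
        Real.sin (k * Real.pi * (2 * s + 1) / N) := by
    have e₁ : k * Real.pi * (2 * (s + 1 : ℕ) + 1) / N =
        k * (2 * Real.pi * (s + 1) / N) + k * Real.pi / N := by
      push_cast
      ring
    have e₂ : k * Real.pi * (2 * s + 1) / N =
        k * (2 * Real.pi * (s + 1) / N) - k * Real.pi / N := by
      ring
    rw [e₁, e₂, Real.sin_add, Real.sin_sub]
    ring
  rw [Finset.mul_sum, Finset.sum_congr rfl fun s _ => step s,
    Finset.sum_range_sub fun s : ℕ => Real.sin (k * Real.pi * (2 * s + 1) / N), sub_eq_zero]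
  have e : k * Real.pi * (2 * N + 1) / N =
      k * Real.pi * (2 * (0 : ℕ) + 1) / N + k * (2 * Real.pi) := by
    field_simp
    push_cast
    ring
  rw [e, Real.sin_add_int_mul_two_pi]

theorem sum_sin_int_mul_eq_zero {N : ℕ} {k : ℤ} (hk : k = 0 ∨ ¬ (N : ℤ) ∣ k) (hN : N ≠ 0) :
    ∑ s : Fin N, Real.sin (k * (2 * Real.pi * (s.val + 1) / N)) = 0 := by
  obtain rfl | hk := hk
  · simp
  have hN' : (N : ℝ) ≠ 0 := Nat.cast_ne_zero.mpr hN
  rw [Fin.sum_univ_eq_sum_range (fun s : ℕ => Real.sin (k * (2 * Real.pi * (s + 1) / N)))]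
  refine (mul_eq_zero.mp ?_).resolve_left
    (mul_ne_zero (neg_ne_zero.mpr two_ne_zero) (sin_int_mul_pi_div_ne_zero hk hN))
  have step (s : ℕ) : -2 * Real.sin (k * Real.pi / N) *
      Real.sin (k * (2 * Real.pi * (s + 1) / N)) =
      Real.cos (k * Real.pi * (2 * (s + 1 : ℕ) + 1) / N) -
        Real.cos (k * Real.pi * (2 * s + 1) / N) := by
    have e₁ : k * Real.pi * (2 * (s + 1 : ℕ) + 1) / N =
        k * (2 * Real.pi * (s + 1) / N) + k * Real.pi / N := by
      push_cast
      ring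
    have e₂ : k * Real.pi * (2 * s + 1) / N =
        k * (2 * Real.pi * (s + 1) / N) - k * Real.pi / N := by
      ring
    rw [e₁, e₂, Real.cos_add, Real.cos_sub]
    ring
  rw [Finset.mul_sum, Finset.sum_congr rfl fun s _ => step s,
    Finset.sum_range_sub fun s : ℕ => Real.cos (k * Real.pi * (2 * s + 1) / N), sub_eq_zero]
  have e : k * Real.pi * (2 * N + 1) / N =
      k * Real.pi * (2 * (0 : ℕ) + 1) / N + k * (2 * Real.pi) := by
    field_simp
    push_cast
    ring
  rw [e, Real.cos_add_int_mul_two_pi]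

section Orthogonality

variable {N a b : ℕ} {θ : Fin N → ℝ}

theorem sum_cos_add (hθ : ∀ s, θ s = 2 * Real.pi * (s.val + 1) / N)
    (ha : 0 < a) (hab : a + b < N) :
    ∑ s, Real.cos ((a : ℝ) * θ s + b * θ s) = 0 := by
  have hd : ¬ (N : ℤ) ∣ (a + b : ℤ) := fun h => by
    have := Int.le_of_dvd (by lia) h
    lia
  rw [← sum_cos_int_mul_eq_zero hd (by lia)]
  refine Finset.sum_congr rfl fun s _ => ?_
  rw [hθ]
  push_cast
  ring_nf

theorem not_dvd_natCast_sub (hab : a + b < N) (hne : a ≠ b) : ¬ (N : ℤ) ∣ (a - b : ℤ) := fun h => by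
  have := Int.eq_zero_of_abs_lt_dvd h (by rw [abs_lt]; lia)
  lia

theorem sum_cos_sub (hθ : ∀ s, θ s = 2 * Real.pi * (s.val + 1) / N) (hab : a + b < N) :
    ∑ s, Real.cos ((a : ℝ) * θ s - b * θ s) = if a = b then (N : ℝ) else 0 := by
  split_ifs with h
  · simp [h]
  rw [← sum_cos_int_mul_eq_zero (not_dvd_natCast_sub hab h) (by lia)]
  refine Finset.sum_congr rfl fun s _ => ?_
  rw [hθ]
  push_cast
  ring_nf

theorem sum_cos_mul_cos (hθ : ∀ s, θ s = 2 * Real.pi * (s.val + 1) / N)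
    (ha : 0 < a) (hab : a + b < N) :
    ∑ s, Real.cos (a * θ s) * Real.cos (b * θ s) = if a = b then (N : ℝ) / 2 else 0 := by
  have h (s : Fin N) : Real.cos (a * θ s) * Real.cos (b * θ s) =
      (Real.cos (a * θ s - b * θ s) + Real.cos (a * θ s + b * θ s)) / 2 := by
    rw [Real.cos_sub, Real.cos_add]
    ring
  rw [Finset.sum_congr rfl fun s _ => h s, ← Finset.sum_div, Finset.sum_add_distrib,
    sum_cos_add hθ ha hab, sum_cos_sub hθ hab]
  split_ifs <;> simp

theorem sum_sin_mul_sin (hθ : ∀ s, θ s = 2 * Real.pi * (s.val + 1) / N)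
    (ha : 0 < a) (hab : a + b < N) :
    ∑ s, Real.sin (a * θ s) * Real.sin (b * θ s) = if a = b then (N : ℝ) / 2 else 0 := by
  have h (s : Fin N) : Real.sin (a * θ s) * Real.sin (b * θ s) =
      (Real.cos (a * θ s - b * θ s) - Real.cos (a * θ s + b * θ s)) / 2 := by
    rw [Real.cos_sub, Real.cos_add]
    ring
  rw [Finset.sum_congr rfl fun s _ => h s, ← Finset.sum_div, Finset.sum_sub_distrib,
    sum_cos_add hθ ha hab, sum_cos_sub hθ hab]
  split_ifs <;> simp

theorem sum_sin_mul_cos (hθ : ∀ s, θ s = 2 * Real.pi * (s.val + 1) / N)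
    (ha : 0 < a) (hab : a + b < N) :
    ∑ s, Real.sin (a * θ s) * Real.cos (b * θ s) = 0 := by
  have hd : ¬ (N : ℤ) ∣ (a + b : ℤ) := fun h => by
    have := Int.le_of_dvd (by lia) h
    lia
  have hs : (a - b : ℤ) = 0 ∨ ¬ (N : ℤ) ∣ (a - b : ℤ) := by
    by_cases h : a = b
    · exact .inl (by lia)
    · exact .inr (not_dvd_natCast_sub hab h)
  have h (s : Fin N) : Real.sin (a * θ s) * Real.cos (b * θ s) =
      (Real.sin ((a - b : ℤ) * (2 * Real.pi * (s.val + 1) / N)) +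
        Real.sin ((a + b : ℤ) * (2 * Real.pi * (s.val + 1) / N))) / 2 := by
    rw [← hθ s]
    push_cast
    rw [sub_mul, add_mul, Real.sin_sub, Real.sin_add]
    ring
  rw [Finset.sum_congr rfl fun s _ => h s, ← Finset.sum_div, Finset.sum_add_distrib,
    sum_sin_int_mul_eq_zero hs (by lia), sum_sin_int_mul_eq_zero (.inr hd) (by lia)]
  simp

end Orthogonality

theorem transpose_mul_self_trig_matrix {K N : ℕ} (hN : 2 * K < N)
    {θ : Fin N → ℝ} (hθ : ∀ s, θ s = 2 * Real.pi * (s.val + 1) / N)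
    {C : Matrix (Fin N) (Fin (2 * K)) ℝ}
    (hC : ∀ s j, C s j =
      if j.val % 2 = 0
        then Real.cos (((j.val / 2 + 1 : ℕ) : ℝ) * θ s)
        else Real.sin (((j.val / 2 + 1 : ℕ) : ℝ) * θ s)) :
    Cᵀ * C = ((N : ℝ) / 2) • (1 : Matrix (Fin (2 * K)) (Fin (2 * K)) ℝ) := by
  ext i j
  have hab : (i.val / 2 + 1) + (j.val / 2 + 1) < N := by lia
  simp only [mul_apply, transpose_apply, Matrix.smul_apply, one_apply, smul_eq_mul, hC, Fin.ext_iff]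
  by_cases hi : i.val % 2 = 0 <;> by_cases hj : j.val % 2 = 0 <;>
    simp only [hi, hj, if_true, if_false]
  · rw [sum_cos_mul_cos hθ (by lia) hab]
    split_ifs <;> lia
  · rw [if_neg (by lia), mul_zero, ← sum_sin_mul_cos hθ (Nat.succ_pos _) (by rwa [add_comm])]
    exact Finset.sum_congr rfl fun s _ => mul_comm _ _
  · rw [sum_sin_mul_cos hθ (by lia) hab, if_neg (by lia), mul_zero]
  · rw [sum_sin_mul_sin hθ (by lia) hab]
    split_ifs <;> lia

/-- In the full-view setting, `L⁺(V) = (4/N²) D⁻¹ Cᵀ V C D⁻¹` is the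
Moore–Penrose pseudo-inverse of `L(M) = C D M D Cᵀ`: `L L⁺ L = L`,
`L⁺ L L⁺ = L⁺`, and `L ∘ L⁺`, `L⁺ ∘ L` are self-adjoint for the Frobenius
inner product `⟨A,B⟩_F = tr(Aᵀ B)`. -/
theorem full_view_pseudo_inverse
    (K N : ℕ) (hK : 1 ≤ K) (hN : 2 * K < N) (ρ : ℝ) (hρ : 1 < ρ)
    (θ : Fin N → ℝ) (hθ : ∀ s, θ s = 2 * Real.pi * (s.val + 1) / N)
    (C : Matrix (Fin N) (Fin (2 * K)) ℝ)
    (hC : ∀ s j, C s j =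
      if j.val % 2 = 0
        then Real.cos (((j.val / 2 + 1 : ℕ) : ℝ) * θ s)
        else Real.sin (((j.val / 2 + 1 : ℕ) : ℝ) * θ s))
    (D : Matrix (Fin (2 * K)) (Fin (2 * K)) ℝ)
    (hD : D = Matrix.diagonal fun j =>
      1 / (2 * Real.pi * ((j.val / 2 + 1 : ℕ) : ℝ) * ρ ^ (j.val / 2 + 1 : ℕ)))
    (L : Matrix (Fin (2 * K)) (Fin (2 * K)) ℝ → Matrix (Fin N) (Fin N) ℝ)
    (hL : ∀ M, L M = C * D * M * D * Cᵀ)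
    (Lp : Matrix (Fin N) (Fin N) ℝ → Matrix (Fin (2 * K)) (Fin (2 * K)) ℝ)
    (hLp : ∀ V, Lp V = (4 / (N : ℝ) ^ 2) • (D⁻¹ * Cᵀ * V * C * D⁻¹)) :
    (∀ M, L (Lp (L M)) = L M) ∧
    (∀ V, Lp (L (Lp V)) = Lp V) ∧
    (∀ (V W : Matrix (Fin N) (Fin N) ℝ),
      ((L (Lp V))ᵀ * W).trace = (Vᵀ * L (Lp W)).trace) ∧
    (∀ (M M' : Matrix (Fin (2 * K)) (Fin (2 * K)) ℝ),
      ((Lp (L M))ᵀ * M').trace = (Mᵀ * Lp (L M')).trace) := by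
  have hN0 : (N : ℝ) ≠ 0 := Nat.cast_ne_zero.mpr (by lia)
  have hCC := transpose_mul_self_trig_matrix hN hθ hC
  have hDu : IsUnit D.det := by
    rw [hD, det_diagonal, isUnit_iff_ne_zero, Finset.prod_ne_zero_iff]
    intro j _
    have := Real.pi_pos
    positivity
  have hDl := nonsing_inv_mul D hDu
  have hDr := mul_nonsing_inv D hDu
  have hLpL (M : Matrix (Fin (2 * K)) (Fin (2 * K)) ℝ) : Lp (L M) = M := by
    have e : D⁻¹ * Cᵀ * (C * D * M * D * Cᵀ) * C * D⁻¹ =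
        D⁻¹ * (Cᵀ * C) * D * M * D * (Cᵀ * C) * D⁻¹ := by
      simp only [Matrix.mul_assoc]
    rw [hLp, hL, e, hCC]
    simp only [Matrix.mul_smul, Matrix.smul_mul, Matrix.mul_one, hDl, Matrix.one_mul,
      Matrix.mul_assoc, hDr, smul_smul]
    rw [show 4 / (N : ℝ) ^ 2 * (N / 2 * (N / 2)) = 1 by field_simp; norm_num, one_smul]
  have hLLp (V : Matrix (Fin N) (Fin N) ℝ) :
      L (Lp V) = (4 / (N : ℝ) ^ 2) • (C * Cᵀ * V * (C * Cᵀ)) := by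
    have e : C * D * (D⁻¹ * Cᵀ * V * C * D⁻¹) * D * Cᵀ =
        C * (D * D⁻¹) * Cᵀ * V * C * (D⁻¹ * D) * Cᵀ := by
      simp only [Matrix.mul_assoc]
    rw [hL, hLp]
    simp only [Matrix.mul_smul, Matrix.smul_mul]
    rw [e, hDl, hDr]
    simp only [Matrix.mul_one, Matrix.mul_assoc]
  refine ⟨fun M => by rw [hLpL], fun V => hLpL _, fun V W => ?_, fun M M' => by rw [hLpL, hLpL]⟩
  rw [hLLp, hLLp, transpose_smul, Matrix.smul_mul, Matrix.mul_smul, trace_smul, trace_smul]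
  congr 1
  simp only [transpose_mul, transpose_transpose]
  rw [Matrix.mul_assoc, Matrix.trace_mul_comm]
  simp only [Matrix.mul_assoc]
end

section
/- Let N be a positive integer, let K₁ ≤ K₂ be positive integers with 2K₂ < N, θ_s = 2πs/N, ρ > 1. For each K ∈ {K₁, K₂}, let C_K be the N×2K real matrix with entries (C_K)_{s,2m-1} = cos(mθ_s), (C_K)_{s,2m} = sin(mθ_s), let D_K be the 2K×2K diagonal matrix with diagonal entries 1/(2π m ρᵐ) in positions 2m-1 and 2m, and define L_K⁺(V) = (4/N²)·D_K⁻¹ C_Kᵀ V C_K D_K⁻¹ for N×N real matrices V. Let J be the 2K₂×2K₁ matrix obtained by stacking the 2K₁×2K₁ identity matrix on top of a zero matrix. Then for every N×N real matrix V, Jᵀ L_{K₂}⁺(V) J = L_{K₁}⁺(V); that is, the submatrix of L_{K₂}⁺(V) formed by its first 2K₁ rows and columns is identical to L_{K₁}⁺(V). -/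
open Matrix

/-- The inverse of a diagonal matrix with nonzero entries is the diagonal of the inverses. -/
theorem Matrix.inv_diagonal_of_ne_zero {n R : Type*} [Fintype n] [DecidableEq n] [Field R]
    {d : n → R} (hd : ∀ i, d i ≠ 0) : (diagonal d)⁻¹ = diagonal fun i => (d i)⁻¹ := by
  apply Matrix.inv_eq_right_inv
  rw [diagonal_mul_diagonal, ← diagonal_one]
  congr 1
  funext i
  exact mul_inv_cancel₀ (hd i)

/-- Right multiplication by the identity stacked on a zero block keeps the leading columns. -/
theorem Matrix.mul_eq_submatrix_castLE {l R : Type*} [NonAssocSemiring R] {m n : ℕ} (h : n ≤ m)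
    (A : Matrix l (Fin m) R) {J : Matrix (Fin m) (Fin n) R}
    (hJ : ∀ i j, J i j = if (i : ℕ) = (j : ℕ) then 1 else 0) :
    A * J = A.submatrix id (Fin.castLE h) := by
  ext i j
  rw [mul_apply, Finset.sum_eq_single (Fin.castLE h j)]
  · simp [hJ]
  · intro k _ hk
    have hkj : (k : ℕ) ≠ j := fun e => hk (Fin.ext e)
    rw [hJ, if_neg hkj, mul_zero]
  · simp

/-- Low-order CGPTs reconstructed by the minimal-norm solution are not
affected by the inclusion of higher orders: for `K₁ ≤ K₂`, `2K₂ < N`, the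
leading `2K₁ × 2K₁` submatrix of `L_{K₂}⁺(V)` equals `L_{K₁}⁺(V)`, where
`L_K⁺(V) = (4/N²) D_K⁻¹ C_Kᵀ V C_K D_K⁻¹` and `J` stacks the identity on a
zero block. -/
theorem low_order_CGPT_unaffected
    (N K₁ K₂ : ℕ) (hK₁ : 1 ≤ K₁) (hK : K₁ ≤ K₂) (hN : 2 * K₂ < N) (ρ : ℝ) (hρ : 1 < ρ)
    (θ : Fin N → ℝ) (hθ : ∀ s, θ s = 2 * Real.pi * (s.val + 1) / N)
    (C₁ : Matrix (Fin N) (Fin (2 * K₁)) ℝ)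
    (hC₁ : ∀ s j, C₁ s j =
      if j.val % 2 = 0
        then Real.cos (((j.val / 2 + 1 : ℕ) : ℝ) * θ s)
        else Real.sin (((j.val / 2 + 1 : ℕ) : ℝ) * θ s))
    (C₂ : Matrix (Fin N) (Fin (2 * K₂)) ℝ)
    (hC₂ : ∀ s j, C₂ s j =
      if j.val % 2 = 0
        then Real.cos (((j.val / 2 + 1 : ℕ) : ℝ) * θ s)
        else Real.sin (((j.val / 2 + 1 : ℕ) : ℝ) * θ s))
    (D₁ : Matrix (Fin (2 * K₁)) (Fin (2 * K₁)) ℝ)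
    (hD₁ : D₁ = Matrix.diagonal fun j =>
      1 / (2 * Real.pi * ((j.val / 2 + 1 : ℕ) : ℝ) * ρ ^ (j.val / 2 + 1 : ℕ)))
    (D₂ : Matrix (Fin (2 * K₂)) (Fin (2 * K₂)) ℝ)
    (hD₂ : D₂ = Matrix.diagonal fun j =>
      1 / (2 * Real.pi * ((j.val / 2 + 1 : ℕ) : ℝ) * ρ ^ (j.val / 2 + 1 : ℕ)))
    (Lp₁ : Matrix (Fin N) (Fin N) ℝ → Matrix (Fin (2 * K₁)) (Fin (2 * K₁)) ℝ)
    (hLp₁ : ∀ V, Lp₁ V = (4 / (N : ℝ) ^ 2) • (D₁⁻¹ * C₁ᵀ * V * C₁ * D₁⁻¹))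
    (Lp₂ : Matrix (Fin N) (Fin N) ℝ → Matrix (Fin (2 * K₂)) (Fin (2 * K₂)) ℝ)
    (hLp₂ : ∀ V, Lp₂ V = (4 / (N : ℝ) ^ 2) • (D₂⁻¹ * C₂ᵀ * V * C₂ * D₂⁻¹))
    (J : Matrix (Fin (2 * K₂)) (Fin (2 * K₁)) ℝ)
    (hJ : ∀ i j, J i j = if (i : ℕ) = (j : ℕ) then 1 else 0) :
    ∀ V : Matrix (Fin N) (Fin N) ℝ, Jᵀ * Lp₂ V * J = Lp₁ V := by
  intro V
  have hd : ∀ j : ℕ, 1 / (2 * Real.pi * ((j / 2 + 1 : ℕ) : ℝ) * ρ ^ (j / 2 + 1 : ℕ)) ≠ 0 := by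
    intro j
    have := zero_lt_one.trans hρ
    positivity
  have hinv₁ := Matrix.inv_diagonal_of_ne_zero fun j : Fin (2 * K₁) => hd j
  have hinv₂ := Matrix.inv_diagonal_of_ne_zero fun j : Fin (2 * K₂) => hd j
  rw [← hD₁] at hinv₁
  rw [← hD₂] at hinv₂
  have key : C₂ * D₂⁻¹ * J = C₁ * D₁⁻¹ := by
    rw [Matrix.mul_eq_submatrix_castLE (Nat.mul_le_mul_left 2 hK) _ hJ, hinv₁, hinv₂]
    ext s j
    simp only [submatrix_apply, mul_diagonal, hC₁, hC₂, id_eq, Fin.val_castLE]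
  have key' : Jᵀ * (D₂⁻¹ * C₂ᵀ) = D₁⁻¹ * C₁ᵀ := by
    simpa [transpose_mul, hinv₁, hinv₂] using congrArg transpose key
  calc Jᵀ * Lp₂ V * J
      = (4 / (N : ℝ) ^ 2) • (Jᵀ * (D₂⁻¹ * C₂ᵀ) * V * (C₂ * D₂⁻¹ * J)) := by
        simp only [hLp₂, Matrix.mul_smul, Matrix.smul_mul, Matrix.mul_assoc]
    _ = Lp₁ V := by
        simp only [key, key', hLp₁, Matrix.mul_assoc]
end

section
/- Let C be a real N×2K matrix and D a symmetric real 2K×2K matrix, set G = D Cᵀ C D, and define L(M) = C D M D Cᵀ. Suppose v₁,…,v_{2K} ∈ ℝ^{2K} form an orthonormal system of eigenvectors of G with G v_n = μ_n v_n for n = 1,…,2K. Then for all a, b, a', b' ∈ {1,…,2K}, ⟨L(v_a v_bᵀ), L(v_{a'} v_{b'}ᵀ)⟩_F = δ_{aa'} δ_{bb'} μ_a μ_b, where δ is the Kronecker symbol. In particular ‖L(v_a v_bᵀ)‖_F = √(μ_a μ_b), so the matrices v_a v_bᵀ are right singular vectors of L with singular values √(μ_a μ_b). -/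
open Matrix

theorem Matrix.mul_vecMulVec_mul_transpose {m n R : Type*} [Fintype n] [CommSemiring R]
    (A : Matrix m n R) (x y : n → R) :
    A * vecMulVec x y * Aᵀ = vecMulVec (A *ᵥ x) (A *ᵥ y) := by
  rw [mul_vecMulVec, vecMulVec_mul, vecMul_transpose]

theorem Matrix.trace_transpose_vecMulVec_mul_vecMulVec {m n R : Type*} [Fintype m] [Fintype n]
    [CommSemiring R] (x x' : m → R) (y y' : n → R) :
    ((vecMulVec x y)ᵀ * vecMulVec x' y').trace = (x ⬝ᵥ x') * (y ⬝ᵥ y') := by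
  rw [transpose_vecMulVec, vecMulVec_mul_vecMulVec, trace_vecMulVec, dotProduct_smul, smul_eq_mul]

theorem Matrix.mulVec_dotProduct_mulVec {m n R : Type*} [Fintype m] [Fintype n]
    [CommSemiring R] (A : Matrix m n R) (x y : n → R) :
    (A *ᵥ x) ⬝ᵥ (A *ᵥ y) = x ⬝ᵥ ((Aᵀ * A) *ᵥ y) := by
  rw [← mulVec_mulVec, dotProduct_mulVec x, vecMul_transpose]

/-- Singular vectors of the limited-view operator: if `v₁,…,v_{2K}` is an
orthonormal system of eigenvectors of `G = D Cᵀ C D` with eigenvalues `μ_n`,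
then `⟨L(v_a v_bᵀ), L(v_{a'} v_{b'}ᵀ)⟩_F = δ_{aa'} δ_{bb'} μ_a μ_b` for
`L(M) = C D M D Cᵀ`; in particular `‖L(v_a v_bᵀ)‖_F = √(μ_a μ_b)`. -/
theorem limited_view_singular_vectors
    (K N : ℕ)
    (C : Matrix (Fin N) (Fin (2 * K)) ℝ)
    (D : Matrix (Fin (2 * K)) (Fin (2 * K)) ℝ) (hD : Dᵀ = D)
    (G : Matrix (Fin (2 * K)) (Fin (2 * K)) ℝ)
    (hG : G = D * Cᵀ * C * D)
    (L : Matrix (Fin (2 * K)) (Fin (2 * K)) ℝ → Matrix (Fin N) (Fin N) ℝ)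
    (hL : ∀ M, L M = C * D * M * D * Cᵀ)
    (v : Fin (2 * K) → Fin (2 * K) → ℝ) (μ : Fin (2 * K) → ℝ)
    (horth : ∀ a b, v a ⬝ᵥ v b = if a = b then (1 : ℝ) else 0)
    (heig : ∀ n, G.mulVec (v n) = μ n • v n) :
    (∀ a b a' b' : Fin (2 * K),
      ((L (vecMulVec (v a) (v b)))ᵀ * L (vecMulVec (v a') (v b'))).trace
        = (if a = a' then (1 : ℝ) else 0) * (if b = b' then (1 : ℝ) else 0) *
            (μ a * μ b)) ∧
    (∀ a b : Fin (2 * K),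
      Real.sqrt (((L (vecMulVec (v a) (v b)))ᵀ * L (vecMulVec (v a) (v b))).trace)
        = Real.sqrt (μ a * μ b)) := by
  have hGram : (C * D)ᵀ * (C * D) = G := by
    rw [transpose_mul, hD, hG]
    simp only [Matrix.mul_assoc]
  have hdot (a b) :
      ((C * D) *ᵥ v a) ⬝ᵥ ((C * D) *ᵥ v b) = (if a = b then (1 : ℝ) else 0) * μ b := by
    rw [mulVec_dotProduct_mulVec, hGram, heig, dotProduct_smul, horth, smul_eq_mul, mul_comm]
  have hrank (a b) : L (vecMulVec (v a) (v b)) =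
      vecMulVec ((C * D) *ᵥ v a) ((C * D) *ᵥ v b) := by
    rw [hL, ← mul_vecMulVec_mul_transpose, transpose_mul, hD]
    simp only [Matrix.mul_assoc]
  have hinner (a b a' b') :
      ((L (vecMulVec (v a) (v b)))ᵀ * L (vecMulVec (v a') (v b'))).trace
        = (if a = a' then (1 : ℝ) else 0) * (if b = b' then (1 : ℝ) else 0) * (μ a * μ b) := by
    rw [hrank, hrank, trace_transpose_vecMulVec_mul_vecMulVec, hdot, hdot]
    split_ifs with ha hb <;> simp_all
  refine ⟨hinner, fun a b => ?_⟩
  rw [hinner, if_pos rfl, if_pos rfl, one_mul, one_mul]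
end
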